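/- Let k ≥ 1, u ∈ S^{k−1}, c ∈ (0, 1], and reals α_1 > α_2 > 0. With u_1, u_2 i.i.d. uniform on S^{k−1}, define H_noise(α_1, α_2) := E[ ( e^{2c·u_1^⊤ u}·α_1² + e^{2c·u_2^⊤ u}·α_2² ) / ( e^{c·u_1^⊤ u}·α_1 + e^{c·u_2^⊤ u}·α_2 )² ]. Then the partial derivative of H_noise with respect to α_1, evaluated at (α_1, α_2), is strictly positive. -/

import Mathlib

open MeasureTheory Real
open scoped RealInnerProductSpace

noncomputable section

/-- Uniform probability measure on the unit sphere `S^{k-1} ⊆ ℝ^k`, defined as the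
normalized `(k-1)`-dimensional Hausdorff measure restricted to the sphere. -/
def sphereUniform (k : ℕ) : Measure (EuclideanSpace ℝ (Fin k)) :=
  ((μH[(k : ℝ) - 1]) (Metric.sphere (0 : EuclideanSpace ℝ (Fin k)) 1))⁻¹ •
    (μH[(k : ℝ) - 1]).restrict (Metric.sphere (0 : EuclideanSpace ℝ (Fin k)) 1)

/-- The noise term `H_noise(α₁, α₂)` of Lemma 10, with the expectation over
`u_1, u_2` i.i.d. uniform on `S^{k-1}`. -/
def Hnoise (k : ℕ) (u : EuclideanSpace ℝ (Fin k)) (c : ℝ) (a1 a2 : ℝ) : ℝ :=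
  ∫ p : EuclideanSpace ℝ (Fin k) × EuclideanSpace ℝ (Fin k),
    (Real.exp (2 * c * ⟪p.1, u⟫) * a1 ^ 2 + Real.exp (2 * c * ⟪p.2, u⟫) * a2 ^ 2) /
      (Real.exp (c * ⟪p.1, u⟫) * a1 + Real.exp (c * ⟪p.2, u⟫) * a2) ^ 2
    ∂((sphereUniform k).prod (sphereUniform k))

lemma cosh_two_lt_four : cosh 2 < 4 := by
  rw [cosh_eq]
  have h1 : exp 2 < 7.4 := by
    have : exp 2 = exp 1 * exp 1 := by rw [← exp_add]; norm_num
    rw [this]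
    nlinarith [exp_one_lt_d9, exp_pos 1]
  have h2 : exp (-2) < 0.6 := by
    rw [exp_neg, inv_lt_comm₀ (exp_pos 2) (by norm_num)]
    have := add_one_lt_exp (x := 2) (by norm_num)
    linarith
  linarith

/-- If `|p| + |q| ≤ 2` and `cosh p ≥ 2`, then `cosh q` is close to `1`. -/
lemma cosh_le_of_two_le_cosh {p q : ℝ} (hpq : |p| + |q| ≤ 2) (hp : 2 ≤ cosh p) :
    cosh q ≤ 13 / 10 := by
  rw [← cosh_abs] at hp ⊢
  have hp0 : 0 ≤ sinh |p| := sinh_nonneg_iff.2 (abs_nonneg p)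
  have hq0 : 0 ≤ sinh |q| := sinh_nonneg_iff.2 (abs_nonneg q)
  have hsum : cosh (|p| + |q|) < 4 := by
    refine lt_of_le_of_lt (cosh_le_cosh.2 ?_) cosh_two_lt_four
    rw [abs_of_nonneg (by positivity)]
    simpa using hpq
  rw [cosh_add] at hsum
  by_contra! hq
  have h1 : 17 / 10 ≤ sinh |p| := by nlinarith [cosh_sq |p|]
  have h2 : 83 / 100 ≤ sinh |q| := by nlinarith [cosh_sq |q|]
  nlinarith [mul_le_mul h1 h2 (by norm_num) hp0, mul_le_mul hp hq.le (by norm_num) (by positivity)]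

lemma mul_cube_lt_mul_cube {A P : ℝ} (hA : 1 ≤ A) (hP4 : P ≤ 4) (hAP : A ≤ P) :
    (P ^ 2 - P * A - 2) * (A + 13 / 10) ^ 3 < 161 / 100 * (A + P) ^ 3 := by
  obtain ⟨a, rfl⟩ : ∃ a, A = 1 + a := ⟨A - 1, by ring⟩
  obtain ⟨v, rfl⟩ : ∃ v, P = 1 + a + v := ⟨P - (1 + a), by ring⟩
  have ha : 0 ≤ a := by linarith
  have hv : 0 ≤ v := by linarith
  have hav : 0 ≤ 3 - a - v := by linarith
  nlinarith [mul_nonneg ha hv, mul_nonneg ha hav, mul_nonneg hv hav,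
    mul_nonneg (mul_nonneg ha hv) hav, mul_nonneg (mul_nonneg ha hv) (mul_nonneg ha hv),
    mul_nonneg (mul_nonneg ha hv) (mul_nonneg ha hav),
    mul_nonneg (mul_nonneg ha ha) (mul_nonneg ha hav),
    mul_nonneg (mul_nonneg ha ha) (mul_nonneg hv hav),
    pow_nonneg ha 3, pow_nonneg hv 3, pow_nonneg ha 4]

lemma kernel_sum_pos_aux {A P Q : ℝ} (hA : 1 ≤ A) (hQ : 1 ≤ Q) (hP4 : P ≤ 4)
    (hQP : Q ≤ P) (hPQ : 2 ≤ P → Q ≤ 13 / 10) :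
    0 < (2 + P * (A - P)) / (A + P) ^ 3 + (2 + Q * (A - Q)) / (A + Q) ^ 3 := by
  have hAP : 0 < A + P := by linarith
  have hAQ : 0 < A + Q := by linarith
  rcases lt_or_ge 0 (2 + P * (A - P)) with h | h
  · have hQ' : 0 < 2 + Q * (A - Q) := by
      rcases le_total Q A with h' | h'
      · nlinarith
      · nlinarith
    positivity
  · have hP2 : 2 ≤ P := by nlinarith
    have hQ13 := hPQ hP2
    have hnum : 161 / 100 ≤ 2 + Q * (A - Q) := by nlinarith
    have hAP' : A ≤ P := by nlinarith
    have key := mul_cube_lt_mul_cube hA hP4 hAP'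
    have h3 : (A + Q) ^ 3 ≤ (A + 13 / 10) ^ 3 := by gcongr
    rw [div_add_div _ _ (by positivity) (by positivity)]
    apply div_pos _ (by positivity)
    have e1 : (P ^ 2 - P * A - 2) * (A + Q) ^ 3 ≤ (P ^ 2 - P * A - 2) * (A + 13 / 10) ^ 3 :=
      mul_le_mul_of_nonneg_left h3 (by nlinarith)
    have e2 : 161 / 100 * (A + P) ^ 3 ≤ (2 + Q * (A - Q)) * (A + P) ^ 3 :=
      mul_le_mul_of_nonneg_right hnum (by positivity)
    nlinarith

lemma kernel_sum_pos {A p q : ℝ} (hA : 1 ≤ A) (hpq : |p| + |q| ≤ 2) :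
    0 < (2 + cosh p * (A - cosh p)) / (A + cosh p) ^ 3 +
      (2 + cosh q * (A - cosh q)) / (A + cosh q) ^ 3 := by
  have bound {x y : ℝ} (h : |x| + |y| ≤ 2) : cosh x ≤ 4 := by
    refine (cosh_le_cosh.2 ?_).trans cosh_two_lt_four.le
    rw [abs_two]
    linarith [abs_nonneg y]
  have hqp : |q| + |p| ≤ 2 := by rwa [add_comm]
  rcases le_total (cosh q) (cosh p) with h | h
  · exact kernel_sum_pos_aux hA (one_le_cosh q) (bound hpq) h (cosh_le_of_two_le_cosh hpq)
  · rw [add_comm]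
    exact kernel_sum_pos_aux hA (one_le_cosh p) (bound hqp) h (cosh_le_of_two_le_cosh hqp)

/-- The derivative in `t` of the integrand, with `x`, `y` the exponents. -/
def noiseDeriv (x y t s : ℝ) : ℝ :=
  2 * exp x * exp y * s * (exp x * t - exp y * s) / (exp x * t + exp y * s) ^ 3

lemma noiseDeriv_add_neg {x y t s : ℝ} (ht : 0 < t) (hs : 0 < s) :
    noiseDeriv x y t s + noiseDeriv (-x) (-y) t s =
      (t / s - s / t) / t * ((2 + cosh (x - y) * ((t / s + s / t) / 2 - cosh (x - y))) /
        ((t / s + s / t) / 2 + cosh (x - y)) ^ 3) := by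
  have hX := exp_pos x
  have hY := exp_pos y
  simp only [noiseDeriv, cosh_eq, neg_sub, exp_sub, exp_neg]
  generalize exp x = X at *
  generalize exp y = Y at *
  have h1 : (t / s + s / t) / 2 + (X / Y + Y / X) / 2 =
    (X * t + Y * s) * (Y * t + X * s) / (2 * X * Y * s * t) := by field_simp; ring
  have h2 : X⁻¹ * t + Y⁻¹ * s = (Y * t + X * s) / (X * Y) := by field_simp
  rw [h1, h2]
  have h3 : X * t + Y * s ≠ 0 := by positivity
  have h4 : Y * t + X * s ≠ 0 := by positivity
  generalize h5 : X * t + Y * s = U at *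
  generalize h6 : Y * t + X * s = V at *
  field_simp
  subst h5 h6
  ring

lemma abs_noiseDeriv_le {x y t s : ℝ} (ht : 0 < t) (hs : 0 < s) :
    |noiseDeriv x y t s| ≤ 2 / t := by
  have hX := exp_pos x
  have hY := exp_pos y
  rw [noiseDeriv]
  generalize exp x = X at *
  generalize exp y = Y at *
  rw [abs_div, abs_of_pos (show 0 < (X * t + Y * s) ^ 3 by positivity),
    div_le_div_iff₀ (by positivity) ht, abs_mul,
    abs_of_pos (show 0 < 2 * X * Y * s by positivity)]
  have h : |X * t - Y * s| ≤ X * t + Y * s := by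
    rw [abs_le]; constructor <;> nlinarith [mul_pos hX ht, mul_pos hY hs]
  calc 2 * X * Y * s * |X * t - Y * s| * t
      ≤ 2 * X * Y * s * (X * t + Y * s) * t := by gcongr
    _ = 2 * ((X * t) * (Y * s)) * (X * t + Y * s) := by ring
    _ ≤ 2 * (X * t + Y * s) ^ 2 * (X * t + Y * s) := by
      gcongr
      nlinarith [mul_pos hX ht, mul_pos hY hs]
    _ = _ := by ring

lemma hasDerivAt_noise {x y t s : ℝ} (ht : 0 < t) (hs : 0 < s) :
    HasDerivAt (fun t => (exp (2 * x) * t ^ 2 + exp (2 * y) * s ^ 2) /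
      (exp x * t + exp y * s) ^ 2) (noiseDeriv x y t s) t := by
  have hX := exp_pos x
  have hY := exp_pos y
  have e (z : ℝ) : exp (2 * z) = exp z ^ 2 := by rw [two_mul, exp_add, sq]
  simp only [noiseDeriv, e]
  generalize exp x = X at *
  generalize exp y = Y at *
  have hne : X * t + Y * s ≠ 0 := by positivity
  have hd : HasDerivAt (fun t : ℝ => (X * t + Y * s) ^ 2) (2 * (X * t + Y * s) * X) t := by
    simpa using (((hasDerivAt_id t).const_mul X).add_const (Y * s)).fun_pow 2
  have hn : HasDerivAt (fun t : ℝ => X ^ 2 * t ^ 2 + Y ^ 2 * s ^ 2) (X ^ 2 * (2 * t)) t := by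
    simpa using ((hasDerivAt_pow 2 t).const_mul (X ^ 2)).add_const (Y ^ 2 * s ^ 2)
  refine (hn.div hd (by positivity)).congr_deriv ?_
  field_simp
  ring

lemma noise_abs_le_one {x y t s : ℝ} (ht : 0 < t) (hs : 0 < s) :
    |(exp (2 * x) * t ^ 2 + exp (2 * y) * s ^ 2) / (exp x * t + exp y * s) ^ 2| ≤ 1 := by
  have hX := exp_pos x
  have hY := exp_pos y
  have e (z : ℝ) : exp (2 * z) = exp z ^ 2 := by rw [two_mul, exp_add, sq]
  rw [e, e, abs_of_nonneg (by positivity), div_le_one (by positivity)]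
  nlinarith [mul_pos (mul_pos hX ht) (mul_pos hY hs)]

lemma noiseDeriv_sum_pos {x y t s : ℝ} (hs : 0 < s) (hst : s < t) (hx : |x| ≤ 1) (hy : |y| ≤ 1) :
    0 < noiseDeriv x y t s + noiseDeriv (-x) (-y) t s +
      (noiseDeriv x (-y) t s + noiseDeriv (-x) y t s) := by
  have ht : 0 < t := hs.trans hst
  have h := noiseDeriv_add_neg (x := x) (y := -y) ht hs
  rw [neg_neg] at h
  rw [noiseDeriv_add_neg ht hs, h, ← mul_add]
  have h1 : 0 < t / s - s / t := by
    have := (one_lt_div hs).2 hst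
    have := (div_lt_one ht).2 hst
    linarith
  refine mul_pos (div_pos h1 ht) (kernel_sum_pos ?_ ?_)
  · have : t / s + s / t - 2 = (t - s) ^ 2 / (s * t) := by field_simp; ring
    have : 0 ≤ (t - s) ^ 2 / (s * t) := by positivity
    linarith
  · rw [abs_le] at hx hy
    rcases abs_cases (x - y) with h | h <;> rcases abs_cases (x - -y) with h' | h' <;> linarith

open Measure in
lemma hausdorffMeasure_sphere_ne_zero (n : ℕ) :
    μH[n] (Metric.sphere (0 : EuclideanSpace ℝ (Fin (n + 1))) 1) ≠ 0 := by
  set S := Metric.sphere (0 : EuclideanSpace ℝ (Fin (n + 1))) 1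
  let f : EuclideanSpace ℝ (Fin (n + 1)) → Fin n → ℝ := fun x i => x i.succ
  have hf : LipschitzWith 1 f := LipschitzWith.of_dist_le_mul fun x y => by
    simp only [NNReal.coe_one, one_mul]
    refine (dist_pi_le_iff dist_nonneg).2 fun i => ?_
    rw [dist_eq_norm, dist_eq_norm]
    exact PiLp.norm_apply_le (x - y) i.succ
  let U : Set (Fin n → ℝ) := {y | ∑ i, y i ^ 2 < 1}
  have hU : IsOpen U := isOpen_lt (by fun_prop) continuous_const
  have hUS : U ⊆ f '' S := fun y hy => by
    refine ⟨WithLp.toLp 2 (Fin.cons (√(1 - ∑ i, y i ^ 2)) y), ?_, ?_⟩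
    · have hy' : 0 ≤ 1 - ∑ i, y i ^ 2 := sub_nonneg.2 (le_of_lt hy)
      rw [mem_sphere_zero_iff_norm, ← sq_eq_sq₀ (norm_nonneg _) zero_le_one,
        EuclideanSpace.real_norm_sq_eq]
      simp [Fin.sum_univ_succ, sq_sqrt hy']
    · ext i
      simp [f]
  have hpos : 0 < volume U := hU.measure_pos _ ⟨0, by simp [U]⟩
  have hvol : (μH[n] : Measure (Fin n → ℝ)) = volume := by
    simpa using hausdorffMeasure_pi_real (ι := Fin n)
  have hle := hf.hausdorffMeasure_image_le (d := n) (Nat.cast_nonneg n) S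
  rw [hvol] at hle
  intro h0
  rw [h0, mul_zero] at hle
  exact (hpos.trans_le ((measure_mono hUS).trans hle)).ne rfl

open Measure in
lemma hausdorffMeasure_sphere_lt_top (n : ℕ) :
    μH[n] (Metric.sphere (0 : EuclideanSpace ℝ (Fin (n + 1))) 1) < ⊤ := by
  set S := Metric.sphere (0 : EuclideanSpace ℝ (Fin (n + 1))) 1
  let K : Set (Fin n → ℝ) := Set.Icc (-1) 1
  let g (q : Fin (n + 1) × ℝ) (y : Fin n → ℝ) : EuclideanSpace ℝ (Fin (n + 1)) :=
    WithLp.toLp 2 (q.1.insertNth q.2 y)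
  let f (q : Fin (n + 1) × ℝ) (y : Fin n → ℝ) : EuclideanSpace ℝ (Fin (n + 1)) :=
    ‖g q y‖⁻¹ • g q y
  have hvol : (μH[n] : Measure (Fin n → ℝ)) = volume := by
    simpa using hausdorffMeasure_pi_real (ι := Fin n)
  have himage (q : Fin (n + 1) × ℝ) (hq : q.2 ≠ 0) : μH[n] (f q '' K) < ⊤ := by
    have hg : ContDiff ℝ 1 (g q) := by
      refine (PiLp.contDiff_toLp (p := 2)).comp (contDiff_pi.2 fun i => ?_)
      induction i using Fin.succAboveCases q.1 with
      | x => simpa using contDiff_const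
      | p i => simpa using contDiff_apply ℝ ℝ i
    have hg0 (y) : g q y ≠ 0 := fun h => hq <| by
      simpa [g] using congrArg (fun x : EuclideanSpace ℝ (Fin (n + 1)) => x q.1) h
    have hfc : ContDiff ℝ 1 (f q) :=
      ((hg.norm ℝ hg0).inv fun y => norm_ne_zero_iff.2 (hg0 y)).smul hg
    obtain ⟨C, hC⟩ := hfc.locallyLipschitz.locallyLipschitzOn.exists_lipschitzOnWith_of_compact
      (isCompact_Icc : IsCompact K)
    refine (hC.hausdorffMeasure_image_le (d := n) (Nat.cast_nonneg n)).trans_lt ?_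
    rw [hvol]
    exact ENNReal.mul_lt_top (ENNReal.rpow_lt_top_of_nonneg (Nat.cast_nonneg n)
      ENNReal.coe_ne_top) isCompact_Icc.measure_lt_top
  have hcover : S ⊆ ⋃ i : Fin (n + 1), (f (i, 1) '' K ∪ f (i, -1) '' K) := fun x hx => by
    have hx1 : ‖x‖ = 1 := mem_sphere_zero_iff_norm.1 hx
    obtain ⟨i, hi⟩ := Finite.exists_max fun i => |x i|
    have hxi : 0 < |x i| := by
      by_contra! h
      have : x = 0 := by
        ext j
        exact abs_nonpos_iff.1 ((hi j).trans h)
      simp [this] at hx1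
    have key (s : ℝ) (hs : x i = s * |x i|) : x ∈ f (i, s) '' K := by
      refine ⟨fun j => x (i.succAbove j) / |x i|, ?_, ?_⟩
      · refine Set.mem_Icc.2 ⟨fun j => ?_, fun j => ?_⟩
        · simp only [Pi.neg_apply, Pi.one_apply]
          rw [le_div_iff₀ hxi]
          linarith [neg_abs_le (x (i.succAbove j)), hi (i.succAbove j)]
        · simp only [Pi.one_apply]
          rw [div_le_one hxi]
          exact (le_abs_self _).trans (hi _)
      · have hgx : g (i, s) (fun j => x (i.succAbove j) / |x i|) = |x i|⁻¹ • x := by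
          ext j
          induction j using Fin.succAboveCases i with
          | x => simp only [g, Fin.insertNth_apply_same, PiLp.smul_apply, smul_eq_mul]
                 rw [eq_inv_mul_iff_mul_eq₀ hxi.ne', mul_comm, ← hs]
          | p j => simp [g, div_eq_inv_mul]
        simp only [f, hgx, norm_smul, hx1, norm_inv, norm_eq_abs, abs_abs, mul_one, inv_inv]
        rw [smul_smul, mul_inv_cancel₀ hxi.ne', one_smul]
    refine Set.mem_iUnion.2 ⟨i, ?_⟩
    rcases abs_choice (x i) with h | h
    · exact Or.inl (key 1 (by rw [h, one_mul]))
    · exact Or.inr (key (-1) (by rw [h]; ring))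
  refine (measure_mono hcover).trans_lt ((measure_iUnion_le _).trans_lt ?_)
  rw [tsum_fintype]
  refine ENNReal.sum_lt_top.2 fun i _ => (measure_union_le _ _).trans_lt ?_
  exact ENNReal.add_lt_top.2 ⟨himage _ one_ne_zero, himage _ (by norm_num)⟩

lemma isProbabilityMeasure_sphereUniform {k : ℕ} (hk : 1 ≤ k) :
    IsProbabilityMeasure (sphereUniform k) := by
  obtain ⟨n, rfl⟩ := Nat.exists_eq_add_of_le' hk
  have hd : ((n + 1 : ℕ) : ℝ) - 1 = n := by simp
  refine ⟨?_⟩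
  rw [sphereUniform, hd, Measure.smul_apply, Measure.restrict_apply_univ, smul_eq_mul,
    ENNReal.inv_mul_cancel (hausdorffMeasure_sphere_ne_zero n) (hausdorffMeasure_sphere_lt_top n).ne]

lemma ae_norm_eq_one_sphereUniform (k : ℕ) : ∀ᵐ x ∂(sphereUniform k), ‖x‖ = 1 := by
  refine Measure.ae_smul_measure ?_ _
  filter_upwards [ae_restrict_mem Metric.isClosed_sphere.measurableSet] with x hx
  exact mem_sphere_zero_iff_norm.1 hx

lemma measurePreserving_neg_sphereUniform (k : ℕ) :
    MeasurePreserving Neg.neg (sphereUniform k) (sphereUniform k) := by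
  have h := ((IsometryEquiv.neg (EuclideanSpace ℝ (Fin k))).measurePreserving_hausdorffMeasure
    ((k : ℝ) - 1)).restrict_preimage (s := Metric.sphere 0 1) Metric.isClosed_sphere.measurableSet
  have hs : IsometryEquiv.neg (EuclideanSpace ℝ (Fin k)) ⁻¹' Metric.sphere 0 1 =
      Metric.sphere 0 1 := by
    ext x
    simp
  rw [hs] at h
  exact h.smul_measure _

lemma integral_noiseDeriv_pos {E : Type*} [NormedAddCommGroup E] [MeasurableSpace E] [BorelSpace E]
    [SecondCountableTopology E] {μ : Measure E} [IsProbabilityMeasure μ]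
    (hμ : MeasurePreserving Neg.neg μ μ) {φ : E → ℝ} (hφ : Measurable φ)
    (hodd : ∀ x, φ (-x) = -φ x) (hle : ∀ᵐ x ∂μ, |φ x| ≤ 1) {t s : ℝ} (hs : 0 < s) (hst : s < t) :
    0 < ∫ p, noiseDeriv (φ p.1) (φ p.2) t s ∂(μ.prod μ) := by
  have ht : 0 < t := hs.trans hst
  set D : E × E → ℝ := fun p => noiseDeriv (φ p.1) (φ p.2) t s with hD
  have hDm : Measurable D := by
    unfold D noiseDeriv
    fun_prop
  have hDi : Integrable D (μ.prod μ) :=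
    .of_bound hDm.aestronglyMeasurable (2 / t) (.of_forall fun p => abs_noiseDeriv_le ht hs)
  have hneg {f g : E → E} (hf : MeasurePreserving f μ μ) (hg : MeasurePreserving g μ μ) :
      Integrable (D ∘ Prod.map f g) (μ.prod μ) ∧
        ∫ p, (D ∘ Prod.map f g) p ∂(μ.prod μ) = ∫ p, D p ∂(μ.prod μ) := by
    have h := hf.prod hg
    refine ⟨h.integrable_comp_of_integrable hDi, ?_⟩
    conv_rhs => rw [← h.map_eq]
    exact (integral_map h.measurable.aemeasurable hDm.aestronglyMeasurable).symm
  obtain ⟨i1, e1⟩ := hneg hμ hμ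
  obtain ⟨i2, e2⟩ := hneg (.id μ) hμ
  obtain ⟨i3, e3⟩ := hneg hμ (.id μ)
  have hpos : ∀ᵐ p ∂(μ.prod μ), 0 < (D + D ∘ Prod.map Neg.neg Neg.neg +
      (D ∘ Prod.map id Neg.neg + D ∘ Prod.map Neg.neg id)) p := by
    filter_upwards [Measure.quasiMeasurePreserving_fst.ae hle,
      Measure.quasiMeasurePreserving_snd.ae hle] with p h1 h2
    simpa [D, hodd] using noiseDeriv_sum_pos hs hst h1 h2
  have hsupp := pos_iff_ne_zero.2 fun h0 =>
    let ⟨_, hp, hp0⟩ := (hpos.and (measure_eq_zero_iff_ae_notMem.1 h0)).exists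
    hp0 hp.ne'
  have hint := (integral_pos_iff_support_of_nonneg_ae (hpos.mono fun p hp => hp.le)
    ((hDi.add i1).add (i2.add i3))).2 hsupp
  rw [integral_add' (hDi.add i1) (i2.add i3), integral_add' hDi i1, integral_add' i2 i3,
    e1, e2, e3] at hint
  linarith

/-- Lemma 10: for `0 < c ≤ 1` and `α₁ > α₂ > 0`, the partial derivative of `H_noise`
with respect to `α₁` is strictly positive. -/
theorem Hnoise_deriv_pos (k : ℕ) (hk : 1 ≤ k)
    (u : EuclideanSpace ℝ (Fin k)) (hu : ‖u‖ = 1)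
    (c : ℝ) (hc0 : 0 < c) (hc1 : c ≤ 1)
    (a1 a2 : ℝ) (h12 : a2 < a1) (h2 : 0 < a2) :
    ∃ D : ℝ, 0 < D ∧ HasDerivAt (fun t : ℝ => Hnoise k u c t a2) D a1 := by
  have := isProbabilityMeasure_sphereUniform hk
  have hle : ∀ᵐ x ∂(sphereUniform k), |c * ⟪x, u⟫| ≤ 1 := by
    filter_upwards [ae_norm_eq_one_sphereUniform k] with x hx
    have h := abs_real_inner_le_norm x u
    rw [hx, hu, mul_one] at h
    rw [abs_mul, abs_of_pos hc0]
    exact mul_le_one₀ hc1 (abs_nonneg _) h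
  refine ⟨_, integral_noiseDeriv_pos (measurePreserving_neg_sphereUniform k)
    (φ := fun x => c * ⟪x, u⟫) (by fun_prop) (fun x => by simp) hle h2 h12, ?_⟩
  have h1 : 0 < a1 := h2.trans h12
  simp only [Hnoise, mul_assoc 2 c]
  have hm (t : ℝ) : Measurable fun p : EuclideanSpace ℝ (Fin k) × EuclideanSpace ℝ (Fin k) =>
      (exp (2 * (c * ⟪p.1, u⟫)) * t ^ 2 + exp (2 * (c * ⟪p.2, u⟫)) * a2 ^ 2) /
        (exp (c * ⟪p.1, u⟫) * t + exp (c * ⟪p.2, u⟫) * a2) ^ 2 := by fun_prop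
  have hm' : Measurable fun p : EuclideanSpace ℝ (Fin k) × EuclideanSpace ℝ (Fin k) =>
      noiseDeriv (c * ⟪p.1, u⟫) (c * ⟪p.2, u⟫) a1 a2 := by
    unfold noiseDeriv
    fun_prop
  refine (hasDerivAt_integral_of_dominated_loc_of_deriv_le (bound := fun _ => 2 / (a1 / 2))
    (F' := fun t p => noiseDeriv (c * ⟪p.1, u⟫) (c * ⟪p.2, u⟫) t a2)
    (Ioi_mem_nhds (half_lt_self h1)) (.of_forall fun t => (hm t).aestronglyMeasurable)
    (.of_bound (hm a1).aestronglyMeasurable 1 (.of_forall fun p => noise_abs_le_one h1 h2))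
    hm'.aestronglyMeasurable (.of_forall fun p t ht => ?_) (integrable_const _)
    (.of_forall fun p t ht => hasDerivAt_noise ((half_pos h1).trans ht) h2)).2
  refine (abs_noiseDeriv_le ((half_pos h1).trans ht) h2).trans ?_
  have : a1 / 2 < t := ht
  gcongr
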